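/- Suppose the polynomials a(s) and b(s) are coprime (as real polynomials) and b_i > 0 for at least one i in {0,1,2,3}. If there exists a real number x >= 0 such that condition (C5) holds (with all quantities evaluated at this x), then there exists a real number x >= 0 such that condition (C5) holds and in addition x = 0 or c0(x) = 0 or d2(x) = 0. -/

import Mathlib

/-- A finite list of real numbers "has the same sign" if either all entries are
nonnegative or all entries are nonpositive. -/
def SameSign (l : List ℝ) : Prop := (∀ t ∈ l, 0 ≤ t) ∨ (∀ t ∈ l, t ≤ 0)

/-- The determinant of the Bezoutian matrix of the cubics with coefficients `b` and `a`. -/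
def bezoutDet (b0 b1 b2 b3 a0 a1 a2 a3 : ℝ) : ℝ :=
  (b1 * a0 - b0 * a1) *
      ((b3 * a0 - b0 * a3 + (b2 * a1 - b1 * a2)) * (b3 * a2 - b2 * a3) -
        (b3 * a1 - b1 * a3) ^ 2) -
    (b2 * a0 - b0 * a2) *
      ((b2 * a0 - b0 * a2) * (b3 * a2 - b2 * a3) -
        (b3 * a1 - b1 * a3) * (b3 * a0 - b0 * a3)) +
    (b3 * a0 - b0 * a3) *
      ((b2 * a0 - b0 * a2) * (b3 * a1 - b1 * a3) -
        (b3 * a0 - b0 * a3 + (b2 * a1 - b1 * a2)) * (b3 * a0 - b0 * a3))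

/-- The defining identity of the Bezoutian matrix of two cubics determines its entries. -/
theorem bezoutian_eq {p q : ℝ → ℝ} {p0 p1 p2 p3 q0 q1 q2 q3 : ℝ}
    (hp : ∀ s, p s = p3 * s ^ 3 + p2 * s ^ 2 + p1 * s + p0)
    (hq : ∀ s, q s = q3 * s ^ 3 + q2 * s ^ 2 + q1 * s + q0)
    {M : Matrix (Fin 3) (Fin 3) ℝ}
    (hM : ∀ z w : ℝ, z ≠ w → p z * q w - q z * p w
      = (z - w) * ∑ i : Fin 3, ∑ j : Fin 3, M i j * z ^ (i : ℕ) * w ^ (j : ℕ)) :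
    M = !![p1 * q0 - p0 * q1, p2 * q0 - p0 * q2, p3 * q0 - p0 * q3;
      p2 * q0 - p0 * q2, p3 * q0 - p0 * q3 + (p2 * q1 - p1 * q2), p3 * q1 - p1 * q3;
      p3 * q0 - p0 * q3, p3 * q1 - p1 * q3, p3 * q2 - p2 * q3] := by
  have e1 := hM 0 2 (by norm_num)
  have e2 := hM 0 3 (by norm_num)
  have e3 := hM 0 (-2) (by norm_num)
  have e4 := hM 1 2 (by norm_num)
  have e5 := hM 1 3 (by norm_num)
  have e6 := hM 1 (-2) (by norm_num)
  have e7 := hM (-1) 2 (by norm_num)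
  have e8 := hM (-1) 3 (by norm_num)
  have e9 := hM (-1) (-2) (by norm_num)
  simp only [hp, hq, Fin.sum_univ_three, Fin.val_zero, Fin.val_one, Fin.val_two]
    at e1 e2 e3 e4 e5 e6 e7 e8 e9
  norm_num at e1 e2 e3 e4 e5 e6 e7 e8 e9
  ext i j
  fin_cases i <;> fin_cases j <;> simp <;> linarith

theorem bezoutDet_smul_add (b0 b1 b2 b3 a0 a1 a2 a3 k m n : ℝ) :
    bezoutDet (k * b0) (k * b1) (k * b2) (k * b3)
      (m * a0 - n * b0) (m * a1 - n * b1) (m * a2 - n * b2) (m * a3 - n * b3)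
      = k ^ 3 * m ^ 3 * bezoutDet b0 b1 b2 b3 a0 a1 a2 a3 := by
  unfold bezoutDet
  ring

/-- The Bezoutian determinant of `(1 + x s) D(s) + t s C(s)` and `(1 + x s) C(s)` for
quadratics `C` and `D`. -/
theorem bezoutDet_of_quadratics (c0 c1 c2 d0 d1 d2 x t : ℝ) :
    bezoutDet d0 (d1 + x * d0 + t * c0) (d2 + x * d1 + t * c1) (x * d2 + t * c2)
      c0 (c1 + x * c0) (c2 + x * c1) (x * c2)
      = t * (c0 * x ^ 2 - c1 * x + c2) ^ 2 *
        ((c2 * d1 - c1 * d2) * (c1 * d0 - c0 * d1) - (c2 * d0 - c0 * d2) ^ 2) := by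
  unfold bezoutDet
  ring

/-- Sign conditions on two quadratics with negative resultant are strict as soon as the
two coefficients `c0` and `d2` do not vanish. -/
theorem strict_of_resultant_neg {c0 c1 c2 d0 d1 d2 : ℝ} (hc0 : 0 < c0) (hc1 : 0 ≤ c1)
    (hc2 : 0 ≤ c2) (hd0 : 0 ≤ d0) (hd1 : 0 ≤ d1) (hd2 : 0 < d2)
    (hα : 0 ≤ c2 * d0 - c0 * d2)
    (hl : 0 ≤ d1 * (c1 * d0 - c0 * d1) - d0 * (c2 * d0 - c0 * d2))
    (hr : 0 < (c2 * d1 - c1 * d2) * (c1 * d0 - c0 * d1) - (c2 * d0 - c0 * d2) ^ 2) :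
    0 < c1 ∧ 0 < c2 ∧ 0 < d0 ∧ 0 < d1 ∧ 0 < c2 * d0 - c0 * d2 ∧
      0 < d1 * (c1 * d0 - c0 * d1) - d0 * (c2 * d0 - c0 * d2) := by
  have hcd := mul_pos hc0 hd2
  have hc2' : 0 < c2 := hc2.lt_of_ne (by rintro rfl; linarith)
  have hd0' : 0 < d0 := hd0.lt_of_ne (by rintro rfl; linarith)
  have hP1 : c0 * (c2 * d1 - c1 * d2) + c2 * (c1 * d0 - c0 * d1)
      = c1 * (c2 * d0 - c0 * d2) := by ring
  have hP2 : d0 * (c2 * d1 - c1 * d2) + d2 * (c1 * d0 - c0 * d1)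
      = d1 * (c2 * d0 - c0 * d2) := by ring
  have hd1n : d1 = 0 → 0 ≤ c1 * d0 - c0 * d1 := by
    rintro rfl
    linarith [mul_nonneg hc1 hd0]
  generalize c2 * d0 - c0 * d2 = α2 at *
  generalize c1 * d0 - c0 * d1 = α1 at *
  generalize c2 * d1 - c1 * d2 = β at *
  have hβα : 0 < β * α1 := by linarith [sq_nonneg α2]
  have hα1 : 0 < α1 := by
    rcases hd1.eq_or_lt with h | h
    · exact (hd1n h.symm).lt_of_ne (by rintro rfl; simp at hβα)
    · refine (nonneg_of_mul_nonneg_right (a := d1) ?_ h).lt_of_ne (by rintro rfl; simp at hβα)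
      linarith [mul_nonneg hd0 hα]
  have hβ : 0 < β := pos_of_mul_pos_left hβα hα1.le
  have h1 : 0 < c1 * α2 := by rw [← hP1]; positivity
  have h2 : 0 < d1 * α2 := by rw [← hP2]; positivity
  have hα2 : 0 < α2 := pos_of_mul_pos_right h1 hc1
  refine ⟨pos_of_mul_pos_left h1 hα, hc2', hd0', pos_of_mul_pos_left h2 hα, hα2, ?_⟩
  have h3 : 0 < α2 * (d1 * α1 - d0 * α2) := by
    have : α2 * (d1 * α1 - d0 * α2) = d0 * (β * α1 - α2 ^ 2) + d2 * α1 ^ 2 := by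
      linear_combination (-α1) * hP2
    rw [this]
    positivity
  exact pos_of_mul_pos_right h3 hα

theorem sameSign_iff (l : List ℝ) :
    SameSign l ↔ ∃ σ : ℝ, σ ^ 2 = 1 ∧ ∀ t ∈ l, 0 ≤ σ * t := by
  constructor
  · rintro (h | h)
    · exact ⟨1, by norm_num, by simpa using h⟩
    · exact ⟨-1, by norm_num, by simpa using h⟩
  · rintro ⟨σ, hσ, h⟩
    rcases mul_self_eq_one_iff.mp ((sq σ).symm.trans hσ) with rfl | rfl
    · exact Or.inl (by simpa using h)
    · exact Or.inr (by simpa using h)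

theorem isClosed_setOf_sameSign {L : List (ℝ → ℝ)} (hL : ∀ f ∈ L, Continuous f) :
    IsClosed {x | SameSign (L.map fun f => f x)} := by
  simp only [SameSign, List.forall_mem_map, Set.ofPred_or, Set.ofPred_forall]
  exact (isClosed_biInter fun f hf => isClosed_le continuous_const (hL f hf)).union
    (isClosed_biInter fun f hf => isClosed_le (hL f hf) continuous_const)

/-- if `a` and `b` are coprime cubics with some `b_i > 0` and condition (C5)
holds for some `x ≥ 0`, then there exists `x ≥ 0` at which (C5) holds together with
`x = 0` or `c0(x) = 0` or `d2(x) = 0`. -/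
theorem stmt_15 (a0 a1 a2 a3 b0 b1 b2 b3 : ℝ)
    (a b : ℝ → ℝ)
    (ha : ∀ s, a s = a3 * s ^ 3 + a2 * s ^ 2 + a1 * s + a0)
    (hb : ∀ s, b s = b3 * s ^ 3 + b2 * s ^ 2 + b1 * s + b0)
    (hcop : IsCoprime
      (Polynomial.C a3 * Polynomial.X ^ 3 + Polynomial.C a2 * Polynomial.X ^ 2 +
        Polynomial.C a1 * Polynomial.X + Polynomial.C a0 : Polynomial ℝ)
      (Polynomial.C b3 * Polynomial.X ^ 3 + Polynomial.C b2 * Polynomial.X ^ 2 +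
        Polynomial.C b1 * Polynomial.X + Polynomial.C b0))
    (hbpos : 0 < b0 ∨ 0 < b1 ∨ 0 < b2 ∨ 0 < b3)
    (atil btil : ℝ → ℝ)
    (hatil : ∀ x, atil x = -a0 * x ^ 3 + a1 * x ^ 2 - a2 * x + a3)
    (hbtil : ∀ x, btil x = -b0 * x ^ 3 + b1 * x ^ 2 - b2 * x + b3)
    -- the Bezoutian matrix of `a` and `b`
    (Bab : Matrix (Fin 3) (Fin 3) ℝ) (hBabsymm : Bab.IsSymm)
    (hBab : ∀ z w : ℝ, z ≠ w →
        a z * b w - b z * a w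
          = (z - w) * ∑ i : Fin 3, ∑ j : Fin 3, Bab i j * z ^ (i : ℕ) * w ^ (j : ℕ))
    -- `[c0, c1, c2] = -[x^2, -x, 1] * B(a,b)`
    (c0 c1 c2 : ℝ → ℝ)
    (hc0 : ∀ x, c0 x = -(x ^ 2 * Bab 0 0 + (-x) * Bab 1 0 + 1 * Bab 2 0))
    (hc1 : ∀ x, c1 x = -(x ^ 2 * Bab 0 1 + (-x) * Bab 1 1 + 1 * Bab 2 1))
    (hc2 : ∀ x, c2 x = -(x ^ 2 * Bab 0 2 + (-x) * Bab 1 2 + 1 * Bab 2 2))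
    -- the cubic `c(s) = c2*s^3 + c1*s^2 + c0*s`
    (cf : ℝ → ℝ → ℝ)
    (hcf : ∀ x s, cf x s = c2 x * s ^ 3 + c1 x * s ^ 2 + c0 x * s)
    (ctil : ℝ → ℝ)
    (hctil : ∀ x, ctil x = c0 x * x ^ 2 - c1 x * x + c2 x)
    -- the Bezoutian matrix of the cubics `b` and `c`
    (Bbc : ℝ → Matrix (Fin 3) (Fin 3) ℝ) (hBbcsymm : ∀ x, (Bbc x).IsSymm)
    (hBbc : ∀ x, ∀ z w : ℝ, z ≠ w →
        b z * cf x w - cf x z * b w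
          = (z - w) * ∑ i : Fin 3, ∑ j : Fin 3, Bbc x i j * z ^ (i : ℕ) * w ^ (j : ℕ))
    -- `[d0, d1, d2] = -btil * [x^2, -x, 1] * B(b,c)`
    (d0 d1 d2 : ℝ → ℝ)
    (hd0 : ∀ x, d0 x = -btil x * (x ^ 2 * Bbc x 0 0 + (-x) * Bbc x 1 0 + 1 * Bbc x 2 0))
    (hd1 : ∀ x, d1 x = -btil x * (x ^ 2 * Bbc x 0 1 + (-x) * Bbc x 1 1 + 1 * Bbc x 2 1))
    (hd2 : ∀ x, d2 x = -btil x * (x ^ 2 * Bbc x 0 2 + (-x) * Bbc x 1 2 + 1 * Bbc x 2 2))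
    (alpha1 alpha2 lambda1 : ℝ → ℝ)
    (halpha1 : ∀ x, alpha1 x = c1 x * d0 x - c0 x * d1 x)
    (halpha2 : ∀ x, alpha2 x = c2 x * d0 x - c0 x * d2 x)
    (hlambda1 : ∀ x, lambda1 x = d1 x * alpha1 x - d0 x * alpha2 x)
    -- the Bezoutian matrix of `b` and `a`, and `R0ab` its determinant
    (Bba : Matrix (Fin 3) (Fin 3) ℝ) (hBbasymm : Bba.IsSymm)
    (hBba : ∀ z w : ℝ, z ≠ w →
        b z * a w - a z * b w
          = (z - w) * ∑ i : Fin 3, ∑ j : Fin 3, Bba i j * z ^ (i : ℕ) * w ^ (j : ℕ))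
    (R0ab : ℝ) (hR0 : R0ab = Bba.det)
    (C5 : ℝ → Prop)
    (hC5 : ∀ x, C5 x ↔
      ((0 ≤ a0 ∧ 0 ≤ a1 ∧ 0 ≤ a2 ∧ 0 ≤ a3 ∧ 0 ≤ b0 ∧ 0 ≤ b1 ∧ 0 ≤ b2 ∧ 0 ≤ b3) ∧
        SameSign [atil x, btil x, c0 x, c1 x, c2 x, d0 x, d1 x, d2 x, lambda1 x] ∧
        0 ≤ ctil x ∧ 0 ≤ alpha2 x ∧ 0 < R0ab))
    (hex : ∃ x : ℝ, 0 ≤ x ∧ C5 x) :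
    ∃ x : ℝ, 0 ≤ x ∧ C5 x ∧ (x = 0 ∨ c0 x = 0 ∨ d2 x = 0) := by
  have hBab' := bezoutian_eq ha hb hBab
  have hBba' := bezoutian_eq hb ha hBba
  have hcf' : ∀ x s, cf x s = c2 x * s ^ 3 + c1 x * s ^ 2 + c0 x * s + 0 := by
    intro x s
    rw [hcf, add_zero]
  have hBbc' := fun x => bezoutian_eq hb (hcf' x) (hBbc x)
  simp only [hBab', Matrix.of_apply, Matrix.cons_val] at hc0 hc1 hc2
  simp only [hBbc', Matrix.of_apply, Matrix.cons_val] at hd0 hd1 hd2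
  have hR : R0ab = bezoutDet b0 b1 b2 b3 a0 a1 a2 a3 := by
    rw [hR0, hBba', Matrix.det_fin_three]
    simp only [Matrix.of_apply, Matrix.cons_val, bezoutDet]
    ring
  -- `(1 + x s) C(s) = btil a(s) - atil b(s)`
  have hC0 : ∀ x, c0 x = btil x * a0 - atil x * b0 := by
    intro x; rw [hc0, hatil, hbtil]; ring
  have hC1 : ∀ x, c1 x + x * c0 x = btil x * a1 - atil x * b1 := by
    intro x; rw [hc0, hc1, hatil, hbtil]; ring
  have hC2 : ∀ x, c2 x + x * c1 x = btil x * a2 - atil x * b2 := by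
    intro x; rw [hc1, hc2, hatil, hbtil]; ring
  have hC3 : ∀ x, x * c2 x = btil x * a3 - atil x * b3 := by
    intro x; rw [hc2, hatil, hbtil]; ring
  -- `(1 + x s) D(s) = btil (ctil b(s) - btil s C(s))`
  have hD0 : ∀ x, d0 x = btil x * ctil x * b0 := by
    intro x; rw [hd0, hctil]; ring
  have hD1 : ∀ x, d1 x + x * d0 x + btil x ^ 2 * c0 x = btil x * ctil x * b1 := by
    intro x; rw [hd0, hd1, hctil, hbtil]; ring
  have hD2 : ∀ x, d2 x + x * d1 x + btil x ^ 2 * c1 x = btil x * ctil x * b2 := by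
    intro x; rw [hd1, hd2, hctil, hbtil]; ring
  have hD3 : ∀ x, x * d2 x + btil x ^ 2 * c2 x = btil x * ctil x * b3 := by
    intro x; rw [hd2, hctil, hbtil]; ring
  have hatilc : Continuous atil := by rw [funext hatil]; fun_prop
  have hbtilc : Continuous btil := by rw [funext hbtil]; fun_prop
  have hc0c : Continuous c0 := by rw [funext hc0]; fun_prop
  have hc1c : Continuous c1 := by rw [funext hc1]; fun_prop
  have hc2c : Continuous c2 := by rw [funext hc2]; fun_prop
  have hctilc : Continuous ctil := by rw [funext hctil]; fun_prop
  have hd0c : Continuous d0 := by rw [funext hd0]; fun_prop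
  have hd1c : Continuous d1 := by rw [funext hd1]; fun_prop
  have hd2c : Continuous d2 := by rw [funext hd2]; fun_prop
  have halpha1c : Continuous alpha1 := by rw [funext halpha1]; fun_prop
  have halpha2c : Continuous alpha2 := by rw [funext halpha2]; fun_prop
  have hlambda1c : Continuous lambda1 := by rw [funext hlambda1]; fun_prop
  have hclosed : IsClosed {x : ℝ | 0 ≤ x ∧ C5 x} := by
    simp only [hC5]
    refine isClosed_Ici.inter (isClosed_const.inter (IsClosed.inter ?_
      ((isClosed_le continuous_const hctilc).inter
        ((isClosed_le continuous_const halpha2c).inter isClosed_const))))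
    exact isClosed_setOf_sameSign (L := [atil, btil, c0, c1, c2, d0, d1, d2, lambda1])
      (by simp [*])
  have hbdd : BddBelow {x : ℝ | 0 ≤ x ∧ C5 x} := ⟨0, fun x hx => hx.1⟩
  obtain ⟨hy, hCy⟩ := hclosed.csInf_mem hex hbdd
  have hmin : ∀ x, 0 ≤ x → C5 x → sInf {x : ℝ | 0 ≤ x ∧ C5 x} ≤ x :=
    fun x hx hCx => csInf_le hbdd ⟨hx, hCx⟩
  generalize sInf {x : ℝ | 0 ≤ x ∧ C5 x} = y at hy hCy hmin
  refine ⟨y, hy, hCy, ?_⟩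
  by_contra! hne
  obtain ⟨hy0, hc0y, hd2y⟩ := hne
  have hypos : 0 < y := hy.lt_of_ne' hy0
  obtain ⟨hnonneg, hsign, hctily, halpha2y, hRpos⟩ := (hC5 y).mp hCy
  obtain ⟨σ, hσ, hsign⟩ := (sameSign_iff _).mp hsign
  simp only [List.forall_mem_cons] at hsign
  obtain ⟨sa, sb, sc0, sc1, sc2, sd0, sd1, sd2, sl, -⟩ := hsign
  have hσ0 : σ ≠ 0 := by rintro rfl; norm_num at hσ
  have hbtily : btil y ≠ 0 := by
    intro h
    apply hd2y
    rw [hd2, h]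
    ring
  have pb : 0 < σ * btil y := sb.lt_of_ne' (mul_ne_zero hσ0 hbtily)
  have pc0 : 0 < σ * c0 y := sc0.lt_of_ne' (mul_ne_zero hσ0 hc0y)
  have pd2 : 0 < σ * d2 y := sd2.lt_of_ne' (mul_ne_zero hσ0 hd2y)
  have pct : 0 < ctil y := by
    refine hctily.lt_of_ne' fun h => ?_
    have h0 : d0 y = 0 := by rw [hD0, h]; ring
    rw [halpha2, h0] at halpha2y
    have h2 : σ * c0 y * (σ * d2 y) = c0 y * d2 y := by linear_combination c0 y * d2 y * hσ
    linarith [mul_pos pc0 pd2]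
  have hres : 0 < (c2 y * d1 y - c1 y * d2 y) * (c1 y * d0 y - c0 y * d1 y) -
      (c2 y * d0 y - c0 y * d2 y) ^ 2 := by
    have h := bezoutDet_of_quadratics (c0 y) (c1 y) (c2 y) (d0 y) (d1 y) (d2 y) y (btil y ^ 2)
    rw [hD1, hD2, hD3, hC1, hC2, hC3, hC0 y, hD0 y, bezoutDet_smul_add, ← hR, ← hC0, ← hD0,
      ← hctil] at h
    have hb2 : 0 < btil y ^ 2 := by positivity
    have hpos : 0 < (btil y * ctil y) ^ 3 * btil y ^ 3 * R0ab := by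
      have : (btil y * ctil y) ^ 3 * btil y ^ 3 * R0ab
          = (btil y ^ 2) ^ 3 * ctil y ^ 3 * R0ab := by ring
      rw [this]
      positivity
    rw [h] at hpos
    exact pos_of_mul_pos_right hpos (by positivity)
  have hα2σ : σ * c2 y * (σ * d0 y) - σ * c0 y * (σ * d2 y) = alpha2 y := by
    rw [halpha2]
    linear_combination (c2 y * d0 y - c0 y * d2 y) * hσ
  have hα1σ : σ * c1 y * (σ * d0 y) - σ * c0 y * (σ * d1 y) = alpha1 y := by
    rw [halpha1]
    linear_combination (c1 y * d0 y - c0 y * d1 y) * hσ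
  have hβσ : σ * c2 y * (σ * d1 y) - σ * c1 y * (σ * d2 y)
      = c2 y * d1 y - c1 y * d2 y := by
    linear_combination (c2 y * d1 y - c1 y * d2 y) * hσ
  have hlσ : σ * d1 y * alpha1 y - σ * d0 y * alpha2 y = σ * lambda1 y := by
    rw [hlambda1]
    ring
  obtain ⟨pc1, pc2, pd0, pd1, pα, pl⟩ := strict_of_resultant_neg pc0 sc1 sc2 sd0 sd1 pd2
    (by rwa [hα2σ]) (by rwa [hα1σ, hα2σ, hlσ])
    (by rwa [hα1σ, hα2σ, hβσ, halpha1, halpha2])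
  rw [hα1σ, hα2σ, hlσ] at pl
  rw [hα2σ] at pα
  have ev : ∀ {f : ℝ → ℝ}, Continuous f → 0 < f y → ∀ᶠ x in nhdsWithin y (Set.Iio y), 0 < f x :=
    fun hf h => (hf.continuousAt.eventually (lt_mem_nhds h)).filter_mono nhdsWithin_le_nhds
  have evσ : ∀ {f : ℝ → ℝ}, Continuous f → 0 < σ * f y →
      ∀ᶠ x in nhdsWithin y (Set.Iio y), 0 < σ * f x :=
    fun hf h => ev (continuous_const.mul hf) h
  have evG : ∀ᶠ x in nhdsWithin y (Set.Iio y), 0 < c0 y * x ^ 2 - c1 y * x + c2 y :=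
    ev (f := fun x => c0 y * x ^ 2 - c1 y * x + c2 y) (by fun_prop) (by rwa [← hctil])
  have evlt : ∀ᶠ x in nhdsWithin y (Set.Iio y), x < y := self_mem_nhdsWithin
  obtain ⟨x, hxy, hx, hG, qb, qc0, qc1, qc2, qd0, qd1, qd2, ql, qct, qα⟩ :=
    (evlt.and <| (ev (f := fun x => x) continuous_id hypos).and <| evG.and <|
      (evσ hbtilc pb).and <| (evσ hc0c pc0).and <| (evσ hc1c pc1).and <| (evσ hc2c pc2).and <|
      (evσ hd0c pd0).and <| (evσ hd1c pd1).and <| (evσ hd2c pd2).and <|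
      (evσ hlambda1c pl).and <| (ev hctilc pct).and <| ev halpha2c pα).exists
  have qa : 0 ≤ σ * atil x := by
    have key : σ * btil y * (σ * atil x) = σ * btil x * (σ * atil y) +
        (y - x) * (c0 y * x ^ 2 - c1 y * x + c2 y) := by
      have h : btil y * atil x = btil x * atil y +
          (y - x) * (c0 y * x ^ 2 - c1 y * x + c2 y) := by
        rw [hc0, hc1, hc2, hatil, hatil, hbtil, hbtil]
        ring
      linear_combination h + (btil y * atil x - btil x * atil y) * hσ
    refine nonneg_of_mul_nonneg_right (a := σ * btil y) ?_ pb
    rw [key]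
    have := mul_pos (sub_pos.mpr hxy) hG
    have := mul_nonneg qb.le sa
    linarith
  refine absurd (hmin x hx.le ((hC5 x).mpr ⟨hnonneg, (sameSign_iff _).mpr ⟨σ, hσ, ?_⟩,
    qct.le, qα.le, hRpos⟩)) (not_le.mpr hxy)
  simp only [List.forall_mem_cons]
  exact ⟨qa, qb.le, qc0.le, qc1.le, qc2.le, qd0.le, qd1.le, qd2.le, ql.le, by simp⟩
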